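/- Suppose the HNN-extension 𝔼 = ⟨B, t; t⁻¹Ht = K, φ⟩ satisfies condition (*) and 𝒞 is a root class of groups closed under taking quotient groups. Suppose also that B is 𝒞-quasi-regular with respect to HK and at least one of the following holds: (a) 𝔙 ∈ 𝒞, H/L ∈ 𝒞, and condition (†) holds; (b) 𝔘 ∈ 𝒞, 𝔉 ∈ 𝒞, there exists a homomorphism of B onto a group from 𝒞 acting injectively on L, and condition (‡) holds. If B/H and B/K are residually 𝒞-groups, then 𝔼 is residually a 𝒞-group if and only if B is residually a 𝒞-group. -/

import Mathlib

universe u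

open Subgroup

/-- A class of groups in universe `u`: a property of groups. -/
abbrev GroupClass : Type (u + 1) := (G : Type u) → [inst : Group G] → Prop

/-- The class is closed under isomorphism. -/
def IsoClosed (C : GroupClass.{u}) : Prop :=
  ∀ (G₁ G₂ : Type u) [Group G₁] [Group G₂], (G₁ ≃* G₂) → C G₁ → C G₂

/-- The class is closed under taking subgroups. -/
def SubgroupClosed (C : GroupClass.{u}) : Prop :=
  ∀ (G : Type u) [Group G] (H : Subgroup G), C G → C H

/-- The class is closed under taking quotient groups. -/
def QuotClosed (C : GroupClass.{u}) : Prop :=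
  ∀ (G : Type u) [Group G] (N : Subgroup G) [N.Normal], C G → C (G ⧸ N)

/-- The class is closed under direct products of a finite number of factors. -/
def FinProdClosed (C : GroupClass.{u}) : Prop :=
  ∀ (ι : Type u) [Finite ι] (G : ι → Type u) [∀ i, Group (G i)],
    (∀ i, C (G i)) → C (∀ i, G i)

/-- Gruenberg's condition. -/
def Gruenberg (C : GroupClass.{u}) : Prop :=
  ∀ (X : Type u) [Group X] (Y Z : Subgroup X) (_ : Z ≤ Y) (hY : Y.Normal)
    (hZY : (Z.subgroupOf Y).Normal), C (X ⧸ Y) → C (↥Y ⧸ Z.subgroupOf Y) →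
    ∃ T : Subgroup X, ∃ _ : T.Normal, T ≤ Z ∧ C (X ⧸ T)

/-- A root class of groups. -/
def IsRootClass (C : GroupClass.{u}) : Prop :=
  IsoClosed C ∧ (∃ (G : Type u) (_ : Group G), C G ∧ Nontrivial G) ∧
    SubgroupClosed C ∧ Gruenberg C

/-- `X` is residually a `C`-group. -/
def Residually (C : GroupClass.{u}) (X : Type u) [Group X] : Prop :=
  ∀ x : X, x ≠ 1 → ∃ (G : Type u) (_ : Group G) (f : X →* G),
    Function.Surjective f ∧ C G ∧ f x ≠ 1

/-- Every element has finite order. -/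
def Periodic (G : Type u) [Group G] : Prop := ∀ g : G, IsOfFinOrder g

/-- The class consists only of periodic groups. -/
def PeriodicClass (C : GroupClass.{u}) : Prop := ∀ (G : Type u) [Group G], C G → Periodic G

/-- `Aut_X(Y)`: the subgroup of `Aut(Y)` consisting of the restrictions to `Y`
of the inner automorphisms of `X` (that leave `Y` invariant; when `Y` is normal
in `X` these are the restrictions of all inner automorphisms of `X`). -/
def autOf (X : Type u) [Group X] (Y : Subgroup X) : Subgroup (MulAut Y) where
  carrier := { α | ∃ x : X, ∀ y : Y, ((α y : Y) : X) = x * y * x⁻¹ }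
  one_mem' := ⟨1, fun y => by simp⟩
  mul_mem' := by
    rintro α β ⟨a, ha⟩ ⟨b, hb⟩
    refine ⟨a * b, fun y => ?_⟩
    have h1 : ((α (β y) : Y) : X) = a * (β y) * a⁻¹ := ha (β y)
    have h2 : ((β y : Y) : X) = b * y * b⁻¹ := hb y
    show ((α (β y) : Y) : X) = _
    rw [h1, h2]; group
  inv_mem' := by
    rintro α ⟨a, ha⟩
    refine ⟨a⁻¹, fun y => ?_⟩
    have h : ((α (α⁻¹ y) : Y) : X) = a * (α⁻¹ y) * a⁻¹ := ha (α⁻¹ y)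
    rw [MulAut.apply_inv_self] at h
    rw [h]; group

/-- Conjugation of automorphism groups along an isomorphism `φ : H ≃* K`,
giving `φ ∘ α ∘ φ⁻¹ : Aut K →* Aut H`. -/
def autConjHom {H K : Type u} [Group H] [Group K] (φ : H ≃* K) : MulAut K →* MulAut H where
  toFun α := (φ.trans α).trans φ.symm
  map_one' := by ext x; simp
  map_mul' := fun α β => by
    ext x
    simp [MulAut.mul_apply, MulEquiv.trans_apply, MulEquiv.apply_symm_apply]

/-- `N ∈ 𝒞*(X)`: `N` is normal in `X` and `X/N ∈ 𝒞`. -/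
def inCStar (C : GroupClass.{u}) (X : Type u) [Group X] (N : Subgroup X) : Prop :=
  ∃ _ : N.Normal, C (X ⧸ N)

/-- `X` is `𝒞`-quasi-regular with respect to its subgroup `Y`. -/
def QuasiRegular (C : GroupClass.{u}) (X : Type u) [Group X] (Y : Subgroup X) : Prop :=
  ∀ M : Subgroup Y, inCStar C Y M → ∃ N : Subgroup X, inCStar C X N ∧ N.subgroupOf Y ≤ M

/-- `𝔓(𝒞)`: the set of primes dividing the order of some element of some `𝒞`-group. -/
def primesOf (C : GroupClass.{u}) : Set ℕ :=
  { p | p.Prime ∧ ∃ (Z : Type u) (_ : Group Z), C Z ∧ ∃ z : Z, p ∣ orderOf z }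

/-- `Y` is `𝔓(𝒞)′`-isolated in `X`. -/
def PIsolated (C : GroupClass.{u}) {X : Type u} [Group X] (Y : Subgroup X) : Prop :=
  ∀ (x : X) (q : ℕ), q.Prime → q ∉ primesOf C → x ^ q ∈ Y → x ∈ Y

/-- Every finitely generated subgroup is cyclic. -/
def LocallyCyclic (G : Type u) [Group G] : Prop :=
  ∀ S : Subgroup G, S.FG → IsCyclic S

/-- `A` is a `𝒞`-bounded abelian group. -/
def CBoundedAbelian (C : GroupClass.{u}) (A : Type u) [Group A] : Prop :=
  (∀ a b : A, a * b = b * a) ∧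
  ∀ (N : Subgroup A), ∀ _ : N.Normal, ∀ p ∈ primesOf C,
    (∃ m : ℕ, 0 < m ∧ ∀ x : A ⧸ N, (∃ n : ℕ, x ^ p ^ n = 1) → x ^ m = 1) ∧
    (∃ (Z : Type u) (_ : Group Z), C Z ∧
      Cardinal.mk {x : A ⧸ N // ∃ n : ℕ, x ^ p ^ n = 1} ≤ Cardinal.mk Z)

/-- `X` is a `𝒞`-bounded nilpotent group: it has a finite central series with
`𝒞`-bounded abelian factors. -/
def CBoundedNilpotent (C : GroupClass.{u}) (X : Type u) [Group X] : Prop :=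
  ∃ (n : ℕ) (S : ℕ → Subgroup X), S 0 = ⊥ ∧ S n = ⊤ ∧
    (∀ i < n, S i ≤ S (i + 1)) ∧ (∀ i < n, (S i).Normal) ∧
    (∀ i < n, ∀ x ∈ S (i + 1), ∀ g : X, g⁻¹ * x⁻¹ * g * x ∈ S i) ∧
    (∀ i < n, ∀ _ : ((S i).subgroupOf (S (i + 1))).Normal,
      CBoundedAbelian C (↥(S (i + 1)) ⧸ (S i).subgroupOf (S (i + 1))))

/-- `A` is a normal subgroup of `U` (as subgroups of a common group). -/
def NormalIn {G : Type u} [Group G] (A U : Subgroup G) : Prop := (A.subgroupOf U).Normal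

/-- `G` satisfies a non-trivial identity. -/
def SatisfiesNontrivialIdentity (G : Type u) [Group G] : Prop :=
  ∃ w : FreeGroup ℕ, w ≠ 1 ∧ ∀ f : FreeGroup ℕ →* G, f w = 1

section HNN

variable {B : Type u} [Group B] (H K : Subgroup B) (φ : H ≃* K)

/-- `𝔎 = φ ∘ Aut_B(K) ∘ φ⁻¹`, as a subgroup of `Aut(H)`. -/
def frakK : Subgroup (MulAut H) := (autOf B K).map (autConjHom φ)

/-- `𝔘 = ⟨𝔥, 𝔎⟩ ≤ Aut(H)`. -/
def frakU : Subgroup (MulAut H) := autOf B H ⊔ frakK H K φ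

/-- `𝔙 = ⟨𝔏, 𝔉⟩ ≤ Aut(L)`, where `ψ = φ|_L`. -/
def frakV (ψ : MulAut ↥(H ⊓ K)) : Subgroup (MulAut ↥(H ⊓ K)) :=
  autOf B (H ⊓ K) ⊔ Subgroup.zpowers ψ

/-- `ψ` is the restriction of `φ` to `L = H ⊓ K` (this encodes the
`φ`-invariance of `L` from condition (*)). -/
def IsRestrictionToL (ψ : MulAut ↥(H ⊓ K)) : Prop :=
  ∀ x : ↥(H ⊓ K), ((ψ x : ↥(H ⊓ K)) : B) = ((φ ⟨(x : B), x.2.1⟩ : K) : B)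

/-- `(H ⊓ K)φ = H ⊓ K` : the `φ`-invariance of `L` from condition (*). -/
def PhiInvL : Prop :=
  ((H ⊓ K).subgroupOf H).map φ.toMonoidHom = (H ⊓ K).subgroupOf K

end HNN

section HNNExtra

variable (C : GroupClass.{u}) {B : Type u} [Group B] (H K : Subgroup B) (φ : H ≃* K)

/-- Condition (†): at least one of `𝔥` and `𝔎` is normal in `𝔘`, or `𝔘 ∈ 𝒞`. -/
def CondDag : Prop :=
  NormalIn (autOf B H) (frakU H K φ) ∨ NormalIn (frakK H K φ) (frakU H K φ) ∨
    C ↥(frakU H K φ)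

/-- Condition (‡): at least one of `𝔏` and `𝔉` is normal in `𝔙`, or `𝔙 ∈ 𝒞`. -/
def CondDDag (ψ : MulAut ↥(H ⊓ K)) : Prop :=
  NormalIn (autOf B (H ⊓ K)) (frakV H K ψ) ∨
    NormalIn (Subgroup.zpowers ψ) (frakV H K ψ) ∨ C ↥(frakV H K ψ)

/-- `Q` is a pre-`𝒞`-admissible subgroup of `B`: it is normal, `(H,K,φ)`-compatible,
`B/Q ∈ 𝒞`, and `HQ/Q ∩ KQ/Q = LQ/Q`. -/
def PreAdmissible (Q : Subgroup B) : Prop :=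
  ∃ _ : Q.Normal, ((Q ⊓ H).subgroupOf H).map φ.toMonoidHom = (Q ⊓ K).subgroupOf K ∧
    C (B ⧸ Q) ∧
    (H.map (QuotientGroup.mk' Q)) ⊓ (K.map (QuotientGroup.mk' Q)) =
      (H ⊓ K).map (QuotientGroup.mk' Q)

end HNNExtra

open Function

namespace IsRootClass

variable {C : GroupClass.{u}}

theorem of_injective (hC : IsRootClass C) {G G' : Type u} [Group G] [Group G'] (f : G →* G')
    (hf : Injective f) (h : C G') : C G :=
  hC.1 f.range G (MonoidHom.ofInjective hf).symm (hC.2.2.1 _ f.range h)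

theorem of_extension (hC : IsRootClass C) {G Q A : Type u} [Group G] [Group Q] [Group A]
    (f : G →* Q) (hQ : C Q) (g : f.ker →* A) (hg : Injective g) (hA : C A) : C G := by
  have h1 : C (G ⧸ f.ker) := hC.of_injective _ (QuotientGroup.kerLift_injective f) hQ
  have hn : ((⊥ : Subgroup G).subgroupOf f.ker).Normal := inferInstance
  have h2 : C (f.ker ⧸ (⊥ : Subgroup G).subgroupOf f.ker) := by
    refine hC.of_injective (QuotientGroup.lift _ g ?_) ?_ hA
    · intro x hx
      rw [Subgroup.mem_subgroupOf, Subgroup.mem_bot] at hx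
      rw [show x = 1 from Subtype.ext hx]
      exact one_mem _
    · rw [injective_iff_map_eq_one]
      intro x
      induction x using QuotientGroup.induction_on with
      | H x =>
        intro hx
        have : g x = 1 := hx
        rw [hg.eq_iff' (map_one g)] at this
        rw [this, QuotientGroup.mk_one]
  obtain ⟨T, hT, hT1, hT2⟩ := hC.2.2.2 G f.ker ⊥ bot_le inferInstance hn h1 h2
  refine hC.of_injective (QuotientGroup.mk' T) ?_ hT2
  rw [← MonoidHom.ker_eq_bot_iff, QuotientGroup.ker_mk']
  exact le_bot_iff.1 hT1

theorem prod (hC : IsRootClass C) {A Q : Type u} [Group A] [Group Q] (hA : C A) (hQ : C Q) :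
    C (A × Q) := by
  refine hC.of_extension (MonoidHom.snd A Q) hQ
    ((MonoidHom.fst A Q).comp (MonoidHom.ker (MonoidHom.snd A Q)).subtype) ?_ hA
  rw [injective_iff_map_eq_one]
  rintro ⟨⟨a, q⟩, hq⟩ ha
  exact Subtype.ext (Prod.ext ha hq)

theorem semidirectProduct (hC : IsRootClass C) {A Q : Type u} [Group A] [Group Q]
    (θ : Q →* MulAut A) (hA : C A) (hQ : C Q) : C (A ⋊[θ] Q) := by
  have hr (x : (SemidirectProduct.rightHom (φ := θ)).ker) :
      (x : A ⋊[θ] Q).right = 1 := x.2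
  refine hC.of_extension (SemidirectProduct.rightHom (φ := θ)) hQ
    (MonoidHom.mk' (fun x => (x : A ⋊[θ] Q).left) ?_) ?_ hA
  · intro x y
    simp [hr x]
  · intro x y hxy
    exact Subtype.ext (SemidirectProduct.ext hxy ((hr x).trans (hr y).symm))

theorem wreath (hC : IsRootClass C) {A Q : Type u} [Group A] [Group Q] (hA : C A) (hQ : C Q) :
    C (A ≀ᵣ Q) := by
  let f : A ≀ᵣ Q →* Q := RegularWreathProduct.rightHom
  have hf (x : f.ker) : (x : A ≀ᵣ Q).right = 1 := x.2
  let e : f.ker →* A := MonoidHom.mk' (fun x => (x : A ≀ᵣ Q).left 1) (by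
    intro x y
    simp [hf x])
  have hsub : (e.ker.map f.ker.subtype).subgroupOf f.ker = e.ker :=
    Subgroup.comap_map_eq_self_of_injective f.ker.subtype_injective _
  have hn : ((e.ker.map f.ker.subtype).subgroupOf f.ker).Normal := by
    rw [hsub]; infer_instance
  have h1 : C (A ≀ᵣ Q ⧸ f.ker) := hC.of_injective _ (QuotientGroup.kerLift_injective f) hQ
  have h2 : C (f.ker ⧸ (e.ker.map f.ker.subtype).subgroupOf f.ker) :=
    hC.of_injective ((QuotientGroup.kerLift e).comp
      (QuotientGroup.quotientMulEquivOfEq hsub).toMonoidHom)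
      ((QuotientGroup.kerLift_injective e).comp (MulEquiv.injective _)) hA
  obtain ⟨T, hT, hT1, hT2⟩ := hC.2.2.2 _ f.ker _ (Subgroup.map_subtype_le _) inferInstance hn h1 h2
  refine hC.of_injective (QuotientGroup.mk' T) ?_ hT2
  rw [← MonoidHom.ker_eq_bot_iff, QuotientGroup.ker_mk', eq_bot_iff]
  intro x hx
  have key (y : A ≀ᵣ Q) (hy : y ∈ T) : y.right = 1 ∧ y.left 1 = 1 := by
    obtain ⟨z, hz, rfl⟩ := hT1 hy
    exact ⟨z.2, hz⟩
  rw [Subgroup.mem_bot]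
  refine RegularWreathProduct.ext (funext fun q => ?_) (key x hx).1
  have := (key _ (hT.conj_mem x hx (RegularWreathProduct.inl q⁻¹))).2
  simpa [(key x hx).1] using this

theorem pi (hC : IsRootClass C) {A Q : Type u} [Group A] [Group Q] (hA : C A) (hQ : C Q) :
    C (Q → A) := by
  refine hC.of_injective (MonoidHom.mk' (fun f => (⟨f, 1⟩ : A ≀ᵣ Q)) ?_) ?_ (hC.wreath hA hQ)
  · intro f g
    ext <;> simp
  · intro f g h
    exact congrArg RegularWreathProduct.left h

theorem of_surjective (hC : IsRootClass C) (hquot : QuotClosed C) {G G' : Type u} [Group G]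
    [Group G'] (f : G →* G') (hf : Surjective f) (h : C G) : C G' :=
  hC.1 _ _ (QuotientGroup.quotientKerEquivOfSurjective f hf) (hquot G f.ker h)

theorem map (hC : IsRootClass C) (hquot : QuotClosed C) {G G' : Type u} [Group G]
    [Group G'] (f : G →* G') (S : Subgroup G) (h : C S) : C (S.map f) :=
  hC.of_surjective hquot (f.subgroupMap S) (f.subgroupMap_surjective S) h

theorem range_of_le_ker (hC : IsRootClass C) (hquot : QuotClosed C) {G G' : Type u} [Group G]
    [Group G'] (f : G →* G') (N : Subgroup G) [N.Normal] (hN : N ≤ f.ker) (h : C (G ⧸ N)) :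
    C f.range := by
  refine hC.of_surjective hquot (QuotientGroup.lift N f.rangeRestrict ?_) ?_ h
  · intro x hx
    exact Subtype.ext (hN hx)
  · rintro ⟨_, x, rfl⟩
    exact ⟨QuotientGroup.mk x, rfl⟩

theorem of_le (hC : IsRootClass C) {G : Type u} [Group G] {S T : Subgroup G} (hST : S ≤ T)
    (h : C T) : C S :=
  hC.of_injective (Subgroup.inclusion hST) (Subgroup.inclusion_injective hST) h

theorem sup (hC : IsRootClass C) (hquot : QuotClosed C) {G : Type u} [Group G]
    {S T : Subgroup G} (hn : NormalIn S (S ⊔ T)) (hS : C S) (hT : C T) :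
    C ↥(S ⊔ T) := by
  have : (S.subgroupOf (S ⊔ T)).Normal := hn
  let q := QuotientGroup.mk' (S.subgroupOf (S ⊔ T))
  have hTq : Surjective (q.comp (Subgroup.inclusion (le_sup_right : T ≤ S ⊔ T))) := by
    rw [← MonoidHom.range_eq_top, MonoidHom.range_comp, Subgroup.inclusion_range]
    have hq : (S.subgroupOf (S ⊔ T)).map q = ⊥ := by
      rw [Subgroup.map_eq_bot_iff, QuotientGroup.ker_mk']
    rw [← bot_sup_eq (Subgroup.map q _), ← hq, ← Subgroup.map_sup,
      ← Subgroup.subgroupOf_sup le_sup_left le_sup_right, Subgroup.subgroupOf_self,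
      ← MonoidHom.range_eq_map, MonoidHom.range_eq_top]
    exact QuotientGroup.mk'_surjective _
  have hk (x : q.ker) : ((x : ↥(S ⊔ T)) : G) ∈ S :=
    (QuotientGroup.eq_one_iff (x : ↥(S ⊔ T))).1 x.2
  refine hC.of_extension q (hC.of_surjective hquot _ hTq hT)
    (MonoidHom.mk' (fun x => (⟨x, hk x⟩ : S)) fun x y => rfl) ?_ hS
  intro x y hxy
  exact Subtype.ext (Subtype.ext (congrArg (Subtype.val : S → G) hxy))

/-- If `U` is generated by `S` and `T`, the image of `U` under a homomorphism `r` lies in `C` as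
soon as the images of `S` and `T` do and one of `S`, `T` is normal in `U`, or `U` lies in `C`. -/
theorem map_sup (hC : IsRootClass C) (hquot : QuotClosed C) {G G' : Type u} [Group G] [Group G']
    {S T : Subgroup G} (r : ↥(S ⊔ T) →* G')
    (hS : C ((S.subgroupOf (S ⊔ T)).map r)) (hT : C ((T.subgroupOf (S ⊔ T)).map r))
    (h : NormalIn S (S ⊔ T) ∨ NormalIn T (S ⊔ T) ∨ C ↥(S ⊔ T)) : C r.range := by
  have hr : r.range = (S.subgroupOf (S ⊔ T)).map r ⊔ (T.subgroupOf (S ⊔ T)).map r := by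
    rw [← Subgroup.map_sup, ← Subgroup.subgroupOf_sup le_sup_left le_sup_right,
      Subgroup.subgroupOf_self, ← MonoidHom.range_eq_map]
  have aux (V : Subgroup ↥(S ⊔ T)) (hV : V.Normal) (W : Subgroup G') (hW : W ≤ r.range) :
      NormalIn (V.map r) W := by
    constructor
    intro n hn g
    obtain ⟨v, hv, hv'⟩ := Subgroup.mem_subgroupOf.1 hn
    obtain ⟨x, hx⟩ := hW g.2
    refine ⟨x * v * x⁻¹, hV.conj_mem _ hv _, ?_⟩
    simp [hv', hx]
  rcases h with h | h | h
  · rw [hr]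
    exact hC.sup hquot (aux _ h _ hr.ge) hS hT
  · rw [hr, sup_comm]
    exact hC.sup hquot (aux _ h _ (by rw [sup_comm]; exact hr.ge)) hT hS
  · exact hC.of_surjective hquot r.rangeRestrict r.rangeRestrict_surjective h

end IsRootClass

section Wreath

open RegularWreathProduct

theorem exists_orbit_section {G X : Type u} [Group G] [Group X] (σ : G →* X) :
    ∃ (s : X → G) (r : X → X), (∀ x, σ (s x) * r x = x) ∧ ∀ g x, r (σ g * x) = r x := by
  let S : Setoid X :=
    { r := fun x y => ∃ g, σ g * x = y
      iseqv :=
        { refl := fun x => ⟨1, by simp⟩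
          symm := by
            rintro x _ ⟨g, rfl⟩
            exact ⟨g⁻¹, by simp⟩
          trans := by
            rintro x _ _ ⟨g, rfl⟩ ⟨h, rfl⟩
            exact ⟨h * g, by simp [mul_assoc]⟩ } }
  have h (x : X) : ∃ g, σ g * (Quotient.mk S x).out = x :=
    Quotient.exact (s := S) (Quotient.out_eq (Quotient.mk S x))
  choose s hs using h
  refine ⟨s, fun x => (Quotient.mk S x).out, hs, fun g x => ?_⟩
  have : Quotient.mk S x = Quotient.mk S (σ g * x) := Quotient.sound ⟨g, rfl⟩
  simp only [this]

/-- A twisted Kaloujnine–Krasner embedding: a homomorphism `i` on the kernel of `σ : G →* X` that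
is equivariant with respect to `α : G →* A` induces a homomorphism `G →* A ≀ᵣ X` over `σ` sending
`m ∈ ker σ` to the constant function `i m`. -/
theorem exists_hom_wreath {G X A : Type u} [Group G] [Group X] [Group A] (σ : G →* X)
    (i : σ.ker →* A) (α : G →* A)
    (hα : ∀ (g : G) (m m' : σ.ker), (m' : G) = g * m * g⁻¹ → α g * i m = i m' * α g) :
    ∃ f : G →* A ≀ᵣ X, (∀ g, (f g).right = σ g) ∧ ∀ (m : σ.ker) (x : X), (f m).left x = i m := by
  obtain ⟨s, r, hs, hr⟩ := exists_orbit_section σ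
  have hmem (g : G) (x : X) : g * s ((σ g)⁻¹ * x) * (s x)⁻¹ ∈ σ.ker := by
    have h1 := hs ((σ g)⁻¹ * x)
    rw [← map_inv, hr, map_inv, eq_inv_mul_iff_mul_eq, ← mul_assoc] at h1
    have h2 := h1.trans (hs x).symm
    rw [MonoidHom.mem_ker, map_mul, map_mul, map_inv, mul_right_cancel h2, mul_inv_cancel]
  refine ⟨MonoidHom.mk' (fun g => ⟨fun x => i ⟨_, hmem g x⟩ * α (s x * (s ((σ g)⁻¹ * x))⁻¹), σ g⟩)
    ?_, fun g => rfl, ?_⟩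
  · intro a b
    refine RegularWreathProduct.ext (funext fun x => ?_) (map_mul σ a b)
    simp only [mul_left, Pi.mul_apply]
    have e : (σ (a * b))⁻¹ * x = (σ b)⁻¹ * ((σ a)⁻¹ * x) := by simp [mul_assoc]
    have hm := σ.normal_ker.conj_mem _ (hmem b ((σ a)⁻¹ * x)) (s x * (s ((σ a)⁻¹ * x))⁻¹)
    have h := hα (s x * (s ((σ a)⁻¹ * x))⁻¹) ⟨_, hmem b ((σ a)⁻¹ * x)⟩ ⟨_, hm⟩ rfl
    calc _ = i (⟨_, hmem a x⟩ * ⟨_, hm⟩) * α ((s x * (s ((σ a)⁻¹ * x))⁻¹) *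
              (s ((σ a)⁻¹ * x) * (s ((σ b)⁻¹ * ((σ a)⁻¹ * x)))⁻¹)) := by
            congr 2
            · refine Subtype.ext ?_
              simp only [MulMemClass.mk_mul_mk, e]
              group
            · rw [e]
              group
      _ = _ := by
            rw [map_mul i, map_mul α, mul_assoc, ← mul_assoc (i ⟨_, hm⟩), ← h]
            simp only [mul_assoc]
  · intro m x
    have hm : σ m = 1 := m.2
    have h : (⟨_, hmem m x⟩ : σ.ker) = m := Subtype.ext (by simp [hm])
    simp only [MonoidHom.mk'_apply, h]
    simp [hm]

/-- Two homomorphisms to a wreath product that lie over the same `σ` and agree on `ker σ` are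
conjugate by an element of the base. -/
theorem exists_wreath_conj {G X A : Type u} [Group G] [Group X] [Group A] (σ : G →* X)
    (f₁ f₂ : G →* A ≀ᵣ X) (h₁ : ∀ g, (f₁ g).right = σ g) (h₂ : ∀ g, (f₂ g).right = σ g)
    (h : ∀ m ∈ σ.ker, f₁ m = f₂ m) :
    ∃ d : X → A, ∀ g, (⟨d, 1⟩ : A ≀ᵣ X) * f₂ g = f₁ g * ⟨d, 1⟩ := by
  obtain ⟨s, r, hs, hr⟩ := exists_orbit_section σ
  have m₁ (a b : G) (x : X) : (f₁ (a * b)).left x = (f₁ a).left x * (f₁ b).left ((σ a)⁻¹ * x) := by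
    rw [map_mul, mul_left, Pi.mul_apply, h₁]
  have m₂ (a b : G) (x : X) : (f₂ (a * b)).left x = (f₂ a).left x * (f₂ b).left ((σ a)⁻¹ * x) := by
    rw [map_mul, mul_left, Pi.mul_apply, h₂]
  refine ⟨fun x => (f₁ (s x)).left x * ((f₂ (s x)).left x)⁻¹, fun g =>
    RegularWreathProduct.ext (funext fun x => ?_) (by simp [h₁, h₂])⟩
  simp only [mul_left, Pi.mul_apply, inv_one, one_mul, h₁]
  have hk : (s x)⁻¹ * (g * s ((σ g)⁻¹ * x)) ∈ σ.ker := by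
    have h1 := hs ((σ g)⁻¹ * x)
    rw [← map_inv, hr, map_inv, eq_inv_mul_iff_mul_eq, ← mul_assoc] at h1
    have h2 := h1.trans (hs x).symm
    rw [MonoidHom.mem_ker, map_mul, map_mul, map_inv, mul_right_cancel h2, inv_mul_cancel]
  have e : g * s ((σ g)⁻¹ * x) = s x * ((s x)⁻¹ * (g * s ((σ g)⁻¹ * x))) := by group
  have e₁ := m₁ g (s ((σ g)⁻¹ * x)) x
  have e₂ := m₂ g (s ((σ g)⁻¹ * x)) x
  rw [e, m₁, h _ hk] at e₁
  rw [e, m₂] at e₂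
  rw [← mul_assoc, ← e₁, eq_mul_inv_iff_mul_eq]
  rw [mul_assoc, ← e₂]
  group

/-- Two homomorphisms that interchange the roles of `H` and `K` can be glued along the wreath
product with a nontrivial group. -/
theorem exists_wreath_swap {B W Z : Type u} [Group B] [Group W] [Group Z] [Nontrivial Z]
    (H K : Subgroup B) (φ : H ≃* K) (f₁ f₂ : B →* W) (h₁₂ : ∀ h : H, f₁ h = f₂ (φ h))
    (h₁ : ∀ k ∈ K, f₁ k = 1) (h₂ : ∀ h ∈ H, f₂ h = 1) :
    ∃ (F : B →* W ≀ᵣ Z) (τ : W ≀ᵣ Z), (∀ h : H, τ * F h = F (φ h) * τ) ∧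
      ∀ b, F b = 1 ↔ f₁ b = 1 ∧ f₂ b = 1 := by
  classical
  obtain ⟨z, hz⟩ := exists_ne (1 : Z)
  refine ⟨MonoidHom.mk' (fun b => ⟨fun x => if x = 1 then f₁ b else if x = z then f₂ b else 1, 1⟩)
    ?_, ⟨1, z⟩, ?_, ?_⟩
  · intro a b
    refine RegularWreathProduct.ext (funext fun x => ?_) (by simp)
    simp only [mul_left, Pi.mul_apply, inv_one, one_mul, map_mul]
    split_ifs <;> simp
  · intro h
    refine RegularWreathProduct.ext (funext fun x => ?_) (by simp)
    simp only [MonoidHom.mk'_apply, mul_left, Pi.mul_apply, Pi.one_apply, one_mul, mul_one,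
      h₁ _ (φ h).2, h₂ _ h.2, ite_self, inv_mul_eq_one, h₁₂]
    by_cases hx : x = z
    · simp [hx, hz]
    · simp [hx, Ne.symm hx]
  · intro b
    constructor
    · intro hb
      have hl := congrArg RegularWreathProduct.left hb
      exact ⟨by simpa using congrFun hl 1, by simpa [hz] using congrFun hl z⟩
    · rintro ⟨ha, hb⟩
      exact RegularWreathProduct.ext (funext fun x => by simp [ha, hb]) rfl

end Wreath

namespace HNNExtension

variable {B : Type u} [Group B] {H K : Subgroup B} {φ : H ≃* K}

/-- The value in the HNN-extension of a list of syllables `t ^ u * b`. -/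
def listProd (φ : H ≃* K) (l : List (ℤˣ × B)) : HNNExtension B H K φ :=
  (l.map fun x => t ^ (x.1 : ℤ) * of x.2).prod

@[simp]
theorem listProd_nil : listProd φ [] = 1 := rfl

@[simp]
theorem listProd_cons (a : ℤˣ × B) (l : List (ℤˣ × B)) :
    listProd φ (a :: l) = t ^ (a.1 : ℤ) * of a.2 * listProd φ l := by
  simp [listProd]

theorem exists_eq_of_mul_listProd (g : HNNExtension B H K φ) :
    ∃ (b : B) (l : List (ℤˣ × B)),
      l.IsChain (fun x y => x.2 ∈ toSubgroup H K x.1 → x.1 = y.1) ∧ g = of b * listProd φ l := by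
  obtain ⟨d⟩ := NormalWord.TransversalPair.nonempty B H K
  exact ⟨_, _, ((NormalWord.equiv φ d) g).chain, ((NormalWord.equiv φ d).symm_apply_apply g).symm⟩

/-- The image of the word `l` under `σ` is reduced. -/
def IsReducedImage {X : Type u} [Group X] (σ : HNNExtension B H K φ →* X)
    (l : List (ℤˣ × B)) : Prop :=
  l.IsChain fun x y => (∃ b ∈ toSubgroup H K x.1, σ (of x.2) = σ (of b)) → x.1 = y.1

theorem IsReducedImage.infix {X : Type u} [Group X] {σ : HNNExtension B H K φ →* X}
    {l m : List (ℤˣ × B)} (h : IsReducedImage σ l) (hm : m <:+: l) : IsReducedImage σ m :=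
  List.IsChain.infix h hm

theorem IsReducedImage.of_ker_le {X Y : Type u} [Group X] [Group Y]
    {σ : HNNExtension B H K φ →* X} {σ' : HNNExtension B H K φ →* Y}
    {l : List (ℤˣ × B)} (h : IsReducedImage σ l) (hk : σ'.ker ≤ σ.ker) : IsReducedImage σ' l := by
  refine List.IsChain.imp ?_ h
  rintro x y hxy ⟨b, hb, hb'⟩
  refine hxy ⟨b, hb, ?_⟩
  rw [← div_eq_one, ← map_div] at hb' ⊢
  exact hk hb'

/-- `σ g` lies in the image of the base group. -/
def MapsIntoBase {X : Type u} [Group X] (σ : HNNExtension B H K φ →* X)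
    (g : HNNExtension B H K φ) : Prop :=
  ∃ b : B, σ g = σ (of b)

theorem MapsIntoBase.of_ker_le {X Y : Type u} [Group X] [Group Y]
    {σ : HNNExtension B H K φ →* X} {σ' : HNNExtension B H K φ →* Y}
    {g : HNNExtension B H K φ} (h : MapsIntoBase σ' g) (hk : σ'.ker ≤ σ.ker) :
    MapsIntoBase σ g := by
  obtain ⟨b, hb⟩ := h
  refine ⟨b, ?_⟩
  rw [← div_eq_one, ← map_div] at hb ⊢
  exact hk hb

open RegularWreathProduct

theorem left_listProd_eq_one {X A : Type u} [Group X] [Group A]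
    (σ : HNNExtension B H K φ →* X) (ρ : HNNExtension B H K φ →* A ≀ᵣ X)
    (hρ : ∀ g, (ρ g).right = σ g) (hb : ∀ b, (ρ (of b)).left = 1) (l : List (ℤˣ × B)) (x : X)
    (h : ∀ l₁ a l₂, l = l₁ ++ a :: l₂ →
      (ρ (t ^ (a.1 : ℤ))).left ((σ (listProd φ l₁))⁻¹ * x) = 1) :
    (ρ (listProd φ l)).left x = 1 := by
  induction l generalizing x with
  | nil => simp
  | cons a l ih =>
    have h0 := h [] a l rfl
    have h1 := ih ((σ (t ^ (a.1 : ℤ) * of a.2))⁻¹ * x) fun l₁ a' l₂ hl => by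
      have := h (a :: l₁) a' l₂ (by rw [hl]; rfl)
      rw [listProd_cons, map_mul, mul_inv_rev, mul_assoc] at this
      exact this
    simp only [listProd_nil, map_one, inv_one, one_mul] at h0
    rw [listProd_cons, map_mul, mul_left, Pi.mul_apply, hρ, h1, map_mul, mul_left, Pi.mul_apply,
      h0, hb]
    simp

theorem exists_refinement_of_isSimple {C : GroupClass.{u}} (hC : IsRootClass C)
    {X : Type u} [Group X] (hX : C X) (σ : HNNExtension B H K φ →* X)
    (a : ℤˣ × B) (l : List (ℤˣ × B)) (hred : IsReducedImage σ (a :: l))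
    (hinf : ∀ m, m <:+: a :: l → m ≠ [] → m ≠ a :: l → ¬ MapsIntoBase σ (listProd φ m)) :
    ∃ (Y : Type u) (_ : Group Y) (σ' : HNNExtension B H K φ →* Y), C Y ∧ σ'.ker ≤ σ.ker ∧
      ¬ MapsIntoBase σ' (listProd φ (a :: l)) := by
  classical
  obtain ⟨A, _, hA, _⟩ := hC.2.1
  obtain ⟨z, hz⟩ := exists_ne (1 : A)
  let y : X := if a.1 = 1 then 1 else σ t
  let d : X → A := fun x => if ∃ k ∈ K, x = σ (of k) * y then z else 1
  let F : B →* A ≀ᵣ X := inl.comp (σ.comp of)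
  have hd (k : K) (x : X) : d ((σ (of (k : B)))⁻¹ * x) = d x := by
    have : (∃ k' ∈ K, (σ (of (k : B)))⁻¹ * x = σ (of k') * y) ↔ ∃ k' ∈ K, x = σ (of k') * y := by
      constructor
      · rintro ⟨k', hk', e⟩
        exact ⟨k * k', mul_mem k.2 hk', by rw [map_mul, map_mul, mul_assoc, ← e]; simp⟩
      · rintro ⟨k', hk', e⟩
        exact ⟨(k : B)⁻¹ * k', mul_mem (inv_mem k.2) hk', by simp [e, mul_assoc]⟩
    simp only [d, this]
  let ρ : HNNExtension B H K φ →* A ≀ᵣ X := lift F ⟨d, σ t⟩ (by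
    intro h
    refine RegularWreathProduct.ext (funext fun x => ?_) ?_
    · simp [F, hd]
    · simp only [F, mul_right, MonoidHom.comp_apply, right_inl]
      rw [← map_mul, t_mul_of, map_mul])
  have hρ (g) : (ρ g).right = σ g := by
    have : rightHom.comp ρ = σ := by
      refine hom_ext (MonoidHom.ext fun b => ?_) ?_
      · simp [ρ, F]
      · simp [ρ]
    exact DFunLike.congr_fun this g
  have hb (b : B) : (ρ (of b)).left = 1 := by simp [ρ, F]
  have ht (x : X) : (ρ (t ^ ((1 : ℤˣ) : ℤ))).left x = d x := by simp [ρ]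
  have ht' (x : X) : (ρ (t ^ ((-1 : ℤˣ) : ℤ))).left x = (d (σ t * x))⁻¹ := by simp [ρ]
  refine ⟨A ≀ᵣ X, inferInstance, ρ, hC.wreath hA hX, ?_, ?_⟩
  · intro g hg
    rw [MonoidHom.mem_ker, ← hρ, MonoidHom.mem_ker.1 hg, one_right]
  · rintro ⟨b, hb'⟩
    have h1 : (ρ (listProd φ (a :: l))).left 1 = 1 := by rw [hb', hb]; rfl
    rw [listProd_cons, map_mul, mul_left, Pi.mul_apply, hρ, left_listProd_eq_one σ ρ hρ hb l,
      map_mul, mul_left, Pi.mul_apply, hb, mul_one, Pi.one_apply, mul_one] at h1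
    · rcases Int.units_eq_one_or a.1 with ha | ha
      · have hd1 : d 1 = z := if_pos ⟨1, one_mem _, by simp [y, ha]⟩
        rw [ha, ht, hd1] at h1
        exact hz h1
      · have hd1 : d (σ t) = z := if_pos ⟨1, one_mem _, by simp [y, ha]⟩
        rw [ha, ht', mul_one, hd1, inv_eq_one] at h1
        exact hz h1
    · intro l₁ a' l₂ hl
      rw [← mul_assoc, mul_one, ← mul_inv_rev, ← map_mul, ← listProd_cons]
      have hp : ¬ MapsIntoBase σ (listProd φ (a :: l₁)) := by
        refine hinf _ ⟨[], a' :: l₂, by simp [hl]⟩ (by simp) fun h => ?_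
        simp [hl] at h
      have hturn : ∀ b ∈ toSubgroup H K a.1, σ (of a.2 * listProd φ l₁) = σ (of b) →
          a.1 = a'.1 := by
        intro b hb h
        by_cases hl₁ : l₁ = []
        · subst hl₁
          rw [List.nil_append] at hl
          rw [hl] at hred
          refine (List.isChain_cons_cons.1 hred).1 ⟨b, hb, ?_⟩
          simpa using h
        · refine absurd ?_ (hinf l₁ ⟨[a], a' :: l₂, by simp [hl]⟩ hl₁ fun h => ?_)
          · refine ⟨a.2⁻¹ * b, ?_⟩
            rw [map_mul, map_mul, ← h, map_mul, map_inv, map_inv, inv_mul_cancel_left]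
          · have := congrArg List.length h
            simp [hl] at this
            omega
      have hsymm (k : K) : σ (of ((φ.symm k⁻¹ : H) : B)) = (σ t)⁻¹ * (σ (of (k : B)))⁻¹ * σ t := by
        rw [map_inv, Subgroup.coe_inv, map_inv, equiv_symm_eq_conj]
        simp [mul_assoc]
      have hd1 (x : X) (h : ∀ k ∈ K, x ≠ σ (of k) * y) : d x = 1 :=
        if_neg (by rintro ⟨k, hk, e⟩; exact h k hk e)
      rcases Int.units_eq_one_or a.1 with ha | ha <;> rcases Int.units_eq_one_or a'.1 with ha' | ha'
      · rw [ha', ht]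
        refine hd1 _ fun k hk e => hp ⟨k⁻¹, ?_⟩
        simp only [y, ha, if_true, mul_one] at e
        rw [map_inv, map_inv, ← e, inv_inv]
      · rw [ha', ht', inv_eq_one]
        refine hd1 _ fun k hk e => ?_
        simp only [y, ha, if_true, mul_one] at e
        have := hturn (φ.symm ⟨k, hk⟩⁻¹ : H) (by rw [ha]; exact SetLike.coe_mem _) (by
          rw [hsymm, ← e, listProd_cons, ha]
          simp [mul_assoc])
        rw [ha, ha'] at this
        exact absurd this (by decide)
      · rw [ha', ht]
        refine hd1 _ fun k hk e => ?_
        have hy : y = σ t := if_neg (by rw [ha]; decide)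
        have := hturn k⁻¹ (by rw [ha]; exact inv_mem hk) (by
          rw [hy, eq_comm, ← eq_mul_inv_iff_mul_eq] at e
          rw [map_inv, map_inv, e, listProd_cons, ha]
          simp [mul_assoc])
        rw [ha, ha'] at this
        exact absurd this (by decide)
      · rw [ha', ht', inv_eq_one]
        refine hd1 _ fun k hk e => hp ⟨(φ.symm ⟨k, hk⟩⁻¹ : H), ?_⟩
        have hy : y = σ t := if_neg (by rw [ha]; decide)
        rw [hy, eq_comm, ← eq_mul_inv_iff_mul_eq] at e
        rw [hsymm, e]
        simp [mul_assoc]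

theorem exists_refinement {C : GroupClass.{u}} (hC : IsRootClass C) (n : ℕ) :
    ∀ (l : List (ℤˣ × B)), l.length ≤ n → ∀ (X : Type u) [Group X], C X →
      ∀ (σ : HNNExtension B H K φ →* X), IsReducedImage σ l →
      ∃ (Y : Type u) (_ : Group Y) (σ' : HNNExtension B H K φ →* Y), C Y ∧ σ'.ker ≤ σ.ker ∧
        ∀ m, m <:+: l → m ≠ [] → ¬ MapsIntoBase σ' (listProd φ m) := by
  induction n with
  | zero =>
    intro l hl X _ hX σ _
    rw [Nat.le_zero, List.length_eq_zero_iff] at hl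
    subst hl
    exact ⟨X, inferInstance, σ, hX, le_rfl, fun m hm hm' => absurd (List.infix_nil.1 hm) hm'⟩
  | succ n ih =>
    intro l hl X _ hX σ hred
    rcases l with _ | ⟨a, l⟩
    · exact ⟨X, inferInstance, σ, hX, le_rfl, fun m hm hm' => absurd (List.infix_nil.1 hm) hm'⟩
    have hi₁ : l <:+: a :: l := (List.suffix_cons a l).isInfix
    have hi₂ : (a :: l).dropLast <:+: a :: l := (List.dropLast_prefix _).isInfix
    obtain ⟨Y₁, _, σ₁, hY₁, hk₁, h₁⟩ := ih l (by simpa using hl) X hX σ (hred.infix hi₁)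
    obtain ⟨Y₂, _, σ₂, hY₂, hk₂, h₂⟩ := ih (a :: l).dropLast (by simpa using hl) Y₁ hY₁ σ₁
      ((hred.of_ker_le hk₁).infix hi₂)
    have hproper : ∀ m, m <:+: a :: l → m ≠ [] → m ≠ a :: l →
        ¬ MapsIntoBase σ₂ (listProd φ m) := by
      intro m hm hm0 hml
      rcases List.infix_cons_iff.1 hm with hm | hm
      · refine h₂ m (List.IsPrefix.isInfix ?_) hm0
        obtain ⟨s, hs⟩ := hm
        have hs0 : s ≠ [] := by
          rintro rfl
          exact hml (by simpa using hs)
        rw [← hs, List.dropLast_append_of_ne_nil hs0]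
        exact List.prefix_append _ _
      · exact fun h => h₁ m hm hm0 (h.of_ker_le hk₂)
    obtain ⟨Y, _, σ', hY, hk, h⟩ := exists_refinement_of_isSimple hC hY₂ σ₂ a l
      (hred.of_ker_le (hk₂.trans hk₁)) hproper
    refine ⟨Y, inferInstance, σ', hY, hk.trans (hk₂.trans hk₁), fun m hm hm0 => ?_⟩
    by_cases hml : m = a :: l
    · rwa [hml]
    · exact fun hm' => hproper m hm hm0 hml (hm'.of_ker_le hk)

end HNNExtension

theorem Residually.exists_separating {C : GroupClass.{u}} {B : Type u} [Group B] {N : Subgroup B}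
    [N.Normal] (h : Residually C (B ⧸ N)) {x : B} (hx : x ∉ N) :
    ∃ (Q : Type u) (_ : Group Q) (r : B →* Q), C Q ∧ ∀ b ∈ N, r x ≠ r b := by
  obtain ⟨Q, _, f, -, hQ, hf⟩ := h (x : B ⧸ N) (by rwa [Ne, QuotientGroup.eq_one_iff])
  refine ⟨Q, inferInstance, f.comp (QuotientGroup.mk' N), hQ, fun b hb => ?_⟩
  simpa [(QuotientGroup.eq_one_iff b).2 hb] using hf

theorem IsRootClass.residually_of_forall {C : GroupClass.{u}} (hC : IsRootClass C) {G : Type u}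
    [Group G] (h : ∀ g : G, g ≠ 1 → ∃ (X : Type u) (_ : Group X) (σ : G →* X), C X ∧ σ g ≠ 1) :
    Residually C G := by
  intro g hg
  obtain ⟨X, _, σ, hX, hσ⟩ := h g hg
  exact ⟨σ.range, inferInstance, σ.rangeRestrict, σ.rangeRestrict_surjective,
    hC.2.2.1 X σ.range hX, fun e => hσ (congrArg Subtype.val e)⟩

theorem IsRootClass.residually_of_injective {C : GroupClass.{u}} (hC : IsRootClass C)
    {G G' : Type u} [Group G] [Group G'] (f : G →* G') (hf : Injective f)
    (h : Residually C G') : Residually C G := by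
  refine hC.residually_of_forall fun g hg => ?_
  obtain ⟨X, _, σ, -, hX, hσ⟩ := h (f g) (by rwa [Ne, map_eq_one_iff f hf])
  exact ⟨X, inferInstance, σ.comp f, hX, hσ⟩

namespace HNNExtension

variable {B : Type u} [Group B] {H K : Subgroup B} {φ : H ≃* K}

theorem exists_separating_list {C : GroupClass.{u}} (hC : IsRootClass C) [H.Normal] [K.Normal]
    (hBH : Residually C (B ⧸ H)) (hBK : Residually C (B ⧸ K)) (l : List (ℤˣ × B)) :
    ∃ (Q : Type u) (_ : Group Q) (r : B →* Q), C Q ∧ ∀ x ∈ l, ∀ u, x.2 ∉ toSubgroup H K u →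
      ∀ b ∈ toSubgroup H K u, r x.2 ≠ r b := by
  obtain ⟨A, _, hA, -⟩ := hC.2.1
  induction l with
  | nil => exact ⟨A, inferInstance, 1, hA, by simp⟩
  | cons a l ih =>
    have key (N : Subgroup B) [N.Normal] (h : Residually C (B ⧸ N)) :
        ∃ (Q : Type u) (_ : Group Q) (r : B →* Q), C Q ∧ (a.2 ∉ N → ∀ b ∈ N, r a.2 ≠ r b) := by
      by_cases ha : a.2 ∈ N
      · exact ⟨A, inferInstance, 1, hA, fun h => absurd ha h⟩
      · obtain ⟨Q, _, r, hQ, hr⟩ := h.exists_separating ha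
        exact ⟨Q, inferInstance, r, hQ, fun _ => hr⟩
    obtain ⟨Q, _, r, hQ, hr⟩ := ih
    obtain ⟨Q₁, _, r₁, hQ₁, hr₁⟩ := key H hBH
    obtain ⟨Q₂, _, r₂, hQ₂, hr₂⟩ := key K hBK
    refine ⟨Q × Q₁ × Q₂, inferInstance, r.prod (r₁.prod r₂), hC.prod hQ (hC.prod hQ₁ hQ₂), ?_⟩
    intro x hx u hxu b hb e
    simp only [MonoidHom.prod_apply, Prod.mk.injEq] at e
    rcases List.mem_cons.1 hx with rfl | hx
    · rcases Int.units_eq_one_or u with rfl | rfl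
      · exact hr₁ hxu b hb e.2.1
      · exact hr₂ hxu b hb e.2.2
    · exact hr x hx u hxu b hb e.1

theorem residually {C : GroupClass.{u}} (hC : IsRootClass C) [H.Normal] [K.Normal]
    (hB : Residually C B) (hBH : Residually C (B ⧸ H)) (hBK : Residually C (B ⧸ K))
    (h : ∀ (Q : Type u) [Group Q] (r : B →* Q), C Q →
      ∃ (X : Type u) (_ : Group X) (σ : HNNExtension B H K φ →* X), C X ∧
        ∀ b, σ (of b) = 1 → r b = 1) :
    Residually C (HNNExtension B H K φ) := by
  refine hC.residually_of_forall fun g hg => ?_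
  obtain ⟨b, l, hl, rfl⟩ := exists_eq_of_mul_listProd g
  by_cases hl0 : l = []
  · subst hl0
    rw [listProd_nil, mul_one] at hg ⊢
    obtain ⟨Q, _, r, -, hQ, hr⟩ := hB b (fun e => hg (by rw [e, map_one]))
    obtain ⟨X, _, σ, hX, hσ⟩ := h Q r hQ
    exact ⟨X, inferInstance, σ, hX, fun e => hr (hσ b e)⟩
  · obtain ⟨Q, _, r, hQ, hr⟩ := exists_separating_list hC hBH hBK l
    obtain ⟨X, _, σ, hX, hσ⟩ := h Q r hQ
    have hred : IsReducedImage σ l := by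
      refine List.IsChain.imp_of_mem_imp (R := fun x y => x.2 ∈ toSubgroup H K x.1 → x.1 = y.1)
        (fun x y hx _ hxy => ?_) hl
      rintro ⟨c, hc, e⟩
      refine hxy (by_contra fun hx' => hr x hx _ hx' c hc ?_)
      rw [← div_eq_one, ← map_div]
      exact hσ _ (by rw [map_div, map_div, e, div_self'])
    obtain ⟨Y, _, σ', hY, -, h'⟩ := exists_refinement hC l.length l le_rfl X hX σ hred
    refine ⟨Y, inferInstance, σ', hY, fun e => h' l List.infix_rfl hl0 ⟨b⁻¹, ?_⟩⟩
    rw [map_mul] at e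
    rw [map_inv, map_inv, eq_comm, inv_eq_iff_mul_eq_one, e]

end HNNExtension

theorem conjNormal_mem_autOf {X : Type u} [Group X] (Y : Subgroup X) [Y.Normal] (x : X) :
    MulAut.conjNormal x ∈ autOf X Y :=
  ⟨x, fun y => MulAut.conjNormal_apply x y⟩

/-- `s` is a homomorphism that is compatible with `φ` and separates `H` and `K` modulo `H ⊓ K`. -/
structure IsAdmissible {B Q : Type u} [Group B] [Group Q] {H K : Subgroup B} (φ : H ≃* K)
    (s : B →* Q) : Prop where
  compat (h : H) : s h = 1 ↔ s (φ h) = 1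
  sep : ∀ h ∈ H, ∀ k ∈ K, s (h * k) = 1 → ∃ l ∈ H ⊓ K, s (h * l) = 1

namespace IsRootClass

variable {C : GroupClass.{u}}

theorem exists_core (hC : IsRootClass C) {Y Z : Type u} [Group Y] [Group Z]
    (U : Subgroup (MulAut Y)) (hU : C U) (g : Y →* Z) (hZ : C Z) :
    ∃ (W : Type u) (_ : Group W) (p : Y →* W), C W ∧ (∀ y, p y = 1 → g y = 1) ∧
      ∀ u ∈ U, ∀ y, p (u y) = 1 ↔ p y = 1 := by
  let p : Y →* (U → Z) := MonoidHom.pi fun u : U => g.comp (u : MulAut Y).toMonoidHom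
  have hp (y : Y) : p y = 1 ↔ ∀ u ∈ U, g (u y) = 1 := by
    rw [funext_iff]
    exact ⟨fun h u hu => h ⟨u, hu⟩, fun h u => h u u.2⟩
  refine ⟨U → Z, inferInstance, p, hC.pi hZ hU, fun y hy => (hp y).1 hy 1 U.one_mem, ?_⟩
  intro u hu y
  rw [hp, hp]
  refine ⟨fun h v hv => ?_, fun h v hv => h (v * u) (U.mul_mem hv hu)⟩
  simpa using h (v * u⁻¹) (U.mul_mem hv (U.inv_mem hu))

theorem quotient_ker (hC : IsRootClass C) {G A : Type u} [Group G] [Group A] (f : G →* A)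
    (hA : C A) : C (G ⧸ f.ker) :=
  hC.of_injective (QuotientGroup.kerLift f) (QuotientGroup.kerLift_injective f) hA

theorem quotient_trans (hC : IsRootClass C) (hquot : QuotClosed C) {G W : Type u} [Group G]
    [Group W] (T : Subgroup G) [T.Normal] (hT : C (G ⧸ T)) (p : T →* W) (hW : C W)
    (J : Subgroup G) [J.Normal] (hJ : ∀ t : T, p t = 1 → (t : G) ∈ J) (hJT : J ≤ T) :
    C (G ⧸ J) := by
  let f : G ⧸ J →* G ⧸ T := QuotientGroup.map J T (MonoidHom.id G) hJT
  have hr := hC.range_of_le_ker hquot ((QuotientGroup.mk' J).comp T.subtype) p.ker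
    (fun t ht => by simpa using hJ t ht) (hC.quotient_ker p hW)
  have hle : f.ker ≤ ((QuotientGroup.mk' J).comp T.subtype).range := by
    intro x hx
    obtain ⟨g, rfl⟩ := QuotientGroup.mk_surjective x
    have hg : g ∈ T := (QuotientGroup.eq_one_iff g).1 hx
    exact ⟨⟨g, hg⟩, rfl⟩
  exact hC.of_extension f hT (MonoidHom.id f.ker) injective_id (hC.of_le hle hr)

section

variable {B : Type u} [Group B] {H K : Subgroup B} {φ : H ≃* K}

theorem exists_isAdmissible_of_core (hC : IsRootClass C) (hquot : QuotClosed C)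
    [H.Normal] [K.Normal] (hqr : QuasiRegular C B (H ⊔ K)) (J : Subgroup H) [J.Normal]
    (hJ : C (H ⧸ J)) {Q : Type u} [Group Q] (r : B →* Q) (hQ : C Q)
    (hP : (J.map H.subtype).Normal)
    (hP' : (J.map (K.subtype.comp φ.toMonoidHom)).Normal)
    (hr : ∀ j ∈ J, r j = 1) (hr' : ∀ j ∈ J, r (φ j) = 1)
    (hHJ : ∀ j ∈ J, (φ j : B) ∈ H → (φ j : B) ∈ J.map H.subtype)
    (hKJ : ∀ j ∈ J, (j : B) ∈ K → (j : B) ∈ J.map (K.subtype.comp φ.toMonoidHom)) :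
    ∃ (Q' : Type u) (_ : Group Q') (s : B →* Q'), C Q' ∧ (∀ b, s b = 1 → r b = 1) ∧
      IsAdmissible φ s := by
  set P := J.map H.subtype with hPdef
  set P' := J.map (K.subtype.comp φ.toMonoidHom) with hPdef'
  have hPH : P ≤ H := by
    rintro _ ⟨j, -, rfl⟩
    exact j.2
  have hPK : P' ≤ K := by
    rintro _ ⟨j, -, rfl⟩
    exact (φ j).2
  have hPmem (h : H) : (h : B) ∈ P ↔ h ∈ J := by
    refine ⟨?_, fun hj => ⟨h, hj, rfl⟩⟩
    rintro ⟨j, hj, e⟩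
    rwa [← Subtype.ext e]
  have hPmem' (h : H) : (φ h : B) ∈ P' ↔ h ∈ J := by
    refine ⟨?_, fun hj => ⟨h, hj, rfl⟩⟩
    rintro ⟨j, hj, e⟩
    rwa [← φ.injective (Subtype.ext e)]
  let D := P ⊔ P'
  have hDn : D.Normal := Subgroup.sup_normal P P'
  have hD : D ≤ H ⊔ K := sup_le_sup hPH hPK
  let q := QuotientGroup.mk' D
  have hqH : C (H.map q) := by
    have := hC.range_of_le_ker hquot (q.comp H.subtype) J (fun j hj => by
      rw [MonoidHom.mem_ker, MonoidHom.comp_apply, QuotientGroup.mk'_apply,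
        QuotientGroup.eq_one_iff]
      exact mem_sup_left ⟨j, hj, rfl⟩) hJ
    rwa [MonoidHom.range_comp, range_subtype] at this
  have hqK : C (K.map q) := by
    have := hC.range_of_le_ker hquot (q.comp (K.subtype.comp φ.toMonoidHom)) J (fun j hj => by
      rw [MonoidHom.mem_ker, MonoidHom.comp_apply, QuotientGroup.mk'_apply,
        QuotientGroup.eq_one_iff]
      exact mem_sup_right ⟨j, hj, rfl⟩) hJ
    rwa [MonoidHom.range_comp, MonoidHom.range_comp, MonoidHom.range_eq_top.2 φ.surjective,
      ← MonoidHom.range_eq_map, range_subtype] at this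
  have hqHK : C ((H ⊔ K).map q) := by
    rw [Subgroup.map_sup]
    have : (H.map q).Normal := Subgroup.Normal.map inferInstance q (QuotientGroup.mk'_surjective D)
    exact hC.sup hquot (Subgroup.Normal.subgroupOf this _) hqH hqK
  obtain ⟨N₀, ⟨_, hN₀⟩, hle⟩ := hqr (q.subgroupMap (H ⊔ K)).ker
    ⟨inferInstance, hC.quotient_ker _ hqHK⟩
  have hN₀D : ∀ b ∈ N₀, b ∈ H ⊔ K → b ∈ D := by
    intro b hb hb'
    have : (⟨b, hb'⟩ : ↥(H ⊔ K)) ∈ (q.subgroupMap (H ⊔ K)).ker := hle hb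
    exact (QuotientGroup.eq_one_iff b).1 (congrArg Subtype.val this)
  let f := QuotientGroup.mk' (N₀ ⊔ D)
  have hf : C f.range := hC.range_of_le_ker hquot f N₀ (by
    rw [QuotientGroup.ker_mk']
    exact le_sup_left) hN₀
  let s : B →* f.range × Q := f.rangeRestrict.prod r
  have hs (b : B) : s b = 1 ↔ b ∈ N₀ ⊔ D ∧ r b = 1 := by
    rw [Prod.ext_iff]
    refine and_congr ?_ Iff.rfl
    rw [← QuotientGroup.eq_one_iff, Subtype.ext_iff]
    rfl
  have hsD : ∀ b ∈ H ⊔ K, s b = 1 → b ∈ D := by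
    intro b hb hb'
    obtain ⟨n, hn, d, hd, rfl⟩ := mem_sup_of_normal_right.1 ((hs b).1 hb').1
    exact mul_mem (hN₀D n hn ((mul_mem_cancel_right (hD hd)).1 hb)) hd
  have hsP : ∀ b ∈ P, s b = 1 := by
    rintro _ ⟨j, hj, rfl⟩
    exact (hs _).2 ⟨mem_sup_right (mem_sup_left ⟨j, hj, rfl⟩), hr j hj⟩
  have hsP' : ∀ b ∈ P', s b = 1 := by
    rintro _ ⟨j, hj, rfl⟩
    exact (hs _).2 ⟨mem_sup_right (mem_sup_right ⟨j, hj, rfl⟩), hr' j hj⟩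
  have hsH (h : H) : s h = 1 ↔ h ∈ J := by
    refine ⟨fun e => ?_, fun hj => hsP _ ((hPmem h).2 hj)⟩
    obtain ⟨x, hx, y, hy, e'⟩ := mem_sup_of_normal_right.1 (hsD h (mem_sup_left h.2) e)
    have hyH : y ∈ H := (mul_mem_cancel_left (hPH hx)).1 (e' ▸ h.2)
    rw [← hPmem, ← e']
    refine mul_mem hx ?_
    obtain ⟨j, hj, rfl⟩ := hy
    exact hHJ j hj hyH
  have hsK (h : H) : s (φ h) = 1 ↔ h ∈ J := by
    refine ⟨fun e => ?_, fun hj => hsP' _ ((hPmem' h).2 hj)⟩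
    obtain ⟨x, hx, y, hy, e'⟩ := mem_sup_of_normal_right.1 (hsD _ (mem_sup_right (φ h).2) e)
    have hxK : x ∈ K := (mul_mem_cancel_right (hPK hy)).1 (e' ▸ (φ h).2)
    rw [← hPmem', ← e']
    refine mul_mem ?_ hy
    obtain ⟨j, hj, rfl⟩ := hx
    exact hKJ j hj hxK
  refine ⟨_, inferInstance, s, hC.prod hf hQ, fun b hb => ((hs b).1 hb).2,
    fun h => (hsH h).trans (hsK h).symm, fun h hh k hk e => ?_⟩
  obtain ⟨x, hx, y, hy, e'⟩ := mem_sup_of_normal_right.1 (hsD _ (mul_mem_sup hh hk) e)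
  refine ⟨h⁻¹ * x, ⟨H.mul_mem (H.inv_mem hh) (hPH hx), ?_⟩, by simpa using hsP x hx⟩
  have : h⁻¹ * x = k * y⁻¹ := by
    rw [eq_mul_inv_iff_mul_eq, mul_assoc, e', inv_mul_cancel_left]
  rw [this]
  exact K.mul_mem hk (K.inv_mem (hPK hy))

theorem exists_isAdmissible_of_frakV (hC : IsRootClass C) (hquot : QuotClosed C)
    [H.Normal] [K.Normal] (hqr : QuasiRegular C B (H ⊔ K))
    {ψ : MulAut ↥(H ⊓ K)} (hψ : IsRestrictionToL H K φ ψ) (hV : C ↥(frakV H K ψ))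
    (hHL : C (↥H ⧸ (H ⊓ K).subgroupOf H)) {Q : Type u} [Group Q] (r : B →* Q) (hQ : C Q) :
    ∃ (Q' : Type u) (_ : Group Q') (s : B →* Q'), C Q' ∧ (∀ b, s b = 1 → r b = 1) ∧
      IsAdmissible φ s := by
  obtain ⟨W, _, p, hW, hpr, hpV⟩ := hC.exists_core _ hV (r.comp (H ⊓ K).subtype) hQ
  let J : Subgroup H := p.ker.map (inclusion inf_le_left)
  have hmem (x : B) : x ∈ J.map H.subtype ↔ ∃ l : ↥(H ⊓ K), p l = 1 ∧ (l : B) = x := by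
    constructor
    · rintro ⟨_, ⟨l, hl, rfl⟩, rfl⟩
      exact ⟨l, hl, rfl⟩
    · rintro ⟨l, hl, rfl⟩
      exact ⟨_, ⟨l, hl, rfl⟩, rfl⟩
  have hφ (l : ↥(H ⊓ K)) : ((φ (inclusion inf_le_left l) : K) : B) = ψ l := (hψ l).symm
  have hψV : ψ ∈ frakV H K ψ := mem_sup_right (mem_zpowers ψ)
  have heq : J.map (K.subtype.comp φ.toMonoidHom) = J.map H.subtype := by
    ext x
    rw [hmem]
    constructor
    · rintro ⟨_, ⟨l, hl, rfl⟩, rfl⟩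
      exact ⟨ψ l, (hpV ψ hψV l).2 hl, (hφ l).symm⟩
    · rintro ⟨l, hl, rfl⟩
      obtain ⟨l, rfl⟩ := ψ.surjective l
      exact ⟨_, ⟨l, (hpV ψ hψV l).1 hl, rfl⟩, hφ l⟩
  have hP : (J.map H.subtype).Normal := by
    refine ⟨fun x hx b => ?_⟩
    obtain ⟨l, hl, rfl⟩ := (hmem x).1 hx
    exact (hmem _).2 ⟨MulAut.conjNormal b l,
      (hpV _ (mem_sup_left (conjNormal_mem_autOf _ b)) l).2 hl, MulAut.conjNormal_apply b l⟩
  have hJ : J.Normal := by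
    refine ⟨fun x hx g => ?_⟩
    obtain ⟨y, hy, e⟩ := hP.conj_mem x ⟨x, hx, rfl⟩ g
    rwa [← (Subtype.ext e : y = g * x * g⁻¹)]
  have hJC : C (H ⧸ J) := by
    refine hC.quotient_trans hquot _ hHL
      (p.comp (subgroupOfEquivOfLe (inf_le_left : H ⊓ K ≤ H)).toMonoidHom) hW J
      (fun t ht => ⟨_, ht, rfl⟩) ?_
    rintro _ ⟨l, -, rfl⟩
    exact l.2
  refine hC.exists_isAdmissible_of_core hquot hqr J hJC r hQ hP (heq ▸ hP) ?_ ?_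
    (fun j hj _ => heq ▸ ⟨j, hj, rfl⟩) (fun j hj _ => heq ▸ ⟨j, hj, rfl⟩)
  · rintro _ ⟨l, hl, rfl⟩
    exact hpr l hl
  · rintro _ ⟨l, hl, rfl⟩
    rw [hφ]
    exact hpr _ ((hpV ψ hψV l).2 hl)

theorem exists_isAdmissible_of_frakU (hC : IsRootClass C) (hquot : QuotClosed C)
    [H.Normal] [K.Normal] (hqr : QuasiRegular C B (H ⊔ K)) (hU : C ↥(frakU H K φ))
    {G : Type u} [Group G] (σ : B →* G) (hG : C G) (hσ : Injective (σ.comp (H ⊓ K).subtype))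
    {Q : Type u} [Group Q] (r : B →* Q) (hQ : C Q) :
    ∃ (Q' : Type u) (_ : Group Q') (s : B →* Q'), C Q' ∧ (∀ b, s b = 1 → r b = 1) ∧
      IsAdmissible φ s := by
  let g : H →* (Q × G) × (Q × G) := ((r.prod σ).comp H.subtype).prod
    ((r.prod σ).comp (K.subtype.comp φ.toMonoidHom))
  obtain ⟨W, _, p, hW, hpg, hpU⟩ := hC.exists_core _ hU g
    (hC.prod (hC.prod hQ hG) (hC.prod hQ hG))
  have hg (h : H) (hh : p h = 1) : (r h = 1 ∧ σ h = 1) ∧ r (φ h) = 1 ∧ σ (φ h) = 1 := by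
    simpa [g, Prod.ext_iff] using hpg h hh
  have hL (x : B) (hH : x ∈ H) (hK : x ∈ K) (hx : σ x = 1) : x = 1 := by
    have : (⟨x, hH, hK⟩ : ↥(H ⊓ K)) = 1 := hσ (by simpa using hx)
    exact congrArg Subtype.val this
  refine hC.exists_isAdmissible_of_core hquot hqr p.ker (hC.quotient_ker p hW) r hQ ⟨?_⟩ ⟨?_⟩
    (fun j hj => (hg j hj).1.1) (fun j hj => (hg j hj).2.1) (fun j hj hH => ?_) fun j hj hK => ?_
  · rintro _ ⟨h, hh, rfl⟩ b
    exact ⟨MulAut.conjNormal b h, (hpU _ (mem_sup_left (conjNormal_mem_autOf _ b)) h).2 hh,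
      MulAut.conjNormal_apply b h⟩
  · rintro _ ⟨h, hh, rfl⟩ b
    refine ⟨autConjHom φ (MulAut.conjNormal b) h,
      (hpU _ (mem_sup_right ⟨_, conjNormal_mem_autOf _ b, rfl⟩) h).2 hh, ?_⟩
    simp [autConjHom]
  · rw [hL _ hH (φ j).2 (hg j hj).2.2]
    exact one_mem _
  · rw [hL _ j.2 hK (hg j hj).1.2]
    exact one_mem _

end

end IsRootClass

theorem exists_hom_of_le_sup {G A : Type u} [Group G] [Group A] {S T M : Subgroup G} [T.Normal]
    (hM : M ≤ S ⊔ T) (i : S →* A) (hi : ∀ x : S, (x : G) ∈ T → i x = 1) :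
    ∃ j : M →* A, ∀ (m : M) (x : S), ∀ t ∈ T, (m : G) = x * t → j m = i x := by
  let e := QuotientGroup.quotientInfEquivProdNormalQuotient S T
  let i' : S ⧸ T.subgroupOf S →* A := QuotientGroup.lift _ i hi
  refine ⟨i'.comp (e.symm.toMonoidHom.comp ((QuotientGroup.mk' _).comp (inclusion hM))), ?_⟩
  intro m x t ht hm
  have : e (QuotientGroup.mk x) = QuotientGroup.mk (inclusion hM m) := by
    refine QuotientGroup.eq.2 ?_
    change ((x : G)⁻¹ * (m : G)) ∈ T
    rwa [hm, inv_mul_cancel_left]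
  simp only [MonoidHom.comp_apply, QuotientGroup.mk'_apply, ← this]
  change i' (e.symm (e x)) = i x
  rw [e.symm_apply_apply]
  rfl

/-- The automorphisms of `Y` leaving the subgroup `J` invariant. -/
def invariantAut {Y : Type u} [Group Y] (J : Subgroup Y) : Subgroup (MulAut Y) where
  carrier := {u | ∀ y, u y ∈ J ↔ y ∈ J}
  one_mem' _ := Iff.rfl
  mul_mem' hu hv y := (hu _).trans (hv y)
  inv_mem' {u} hu y := by
    rw [← hu, MulAut.apply_inv_self]

theorem autOf_le_invariantAut {X : Type u} [Group X] (Y N : Subgroup X) [hN : N.Normal] :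
    autOf X Y ≤ invariantAut (N.subgroupOf Y) := by
  rintro u ⟨x, hx⟩ y
  rw [mem_subgroupOf, mem_subgroupOf, hx]
  exact ⟨fun h => by simpa [mul_assoc] using hN.conj_mem _ h x⁻¹, fun h => hN.conj_mem _ h x⟩

/-- The action on `Y ⧸ J` of a group of automorphisms leaving `J` invariant. -/
def quotientAction {Y : Type u} [Group Y] {U : Subgroup (MulAut Y)} {J : Subgroup Y} [J.Normal]
    (hU : U ≤ invariantAut J) : U →* MulAut (Y ⧸ J) :=
  MonoidHom.mk' (fun u => QuotientGroup.congr J J (u : MulAut Y) (by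
    ext y
    constructor
    · rintro ⟨z, hz, rfl⟩
      exact (hU u.2 z).2 hz
    · intro hy
      refine ⟨(u : MulAut Y)⁻¹ y, ?_, MulAut.apply_inv_self Y _ y⟩
      refine (hU u.2 _).1 ?_
      rwa [MulAut.apply_inv_self])) (by
    intro u v
    refine MulEquiv.ext fun y => ?_
    obtain ⟨y, rfl⟩ := QuotientGroup.mk_surjective y
    rfl)

namespace IsRootClass

variable {C : GroupClass.{u}}

theorem exists_equivariant (hC : IsRootClass C) {Y : Type u} [Group Y] {U : Subgroup (MulAut Y)}
    {J : Subgroup Y} [J.Normal] (hU : U ≤ invariantAut J) (hJ : C (Y ⧸ J))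
    (hr : C (quotientAction hU).range) :
    ∃ (A : Type u) (_ : Group A) (i : Y →* A) (ρ : U →* A), C A ∧ (∀ y, i y = 1 ↔ y ∈ J) ∧
      ∀ (u : U) (y : Y), ρ u * i y = i ((u : MulAut Y) y) * ρ u := by
  let r := quotientAction hU
  refine ⟨(Y ⧸ J) ⋊[r.range.subtype] r.range, inferInstance,
    SemidirectProduct.inl.comp (QuotientGroup.mk' J), SemidirectProduct.inr.comp r.rangeRestrict,
    hC.semidirectProduct _ hJ hr, fun y => ?_, fun u y => ?_⟩
  · rw [MonoidHom.comp_apply, map_eq_one_iff _ SemidirectProduct.inl_injective]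
    exact QuotientGroup.eq_one_iff y
  · have := SemidirectProduct.inl_aut (φ := r.range.subtype) (r.rangeRestrict u) (y : Y ⧸ J)
    rw [map_inv, eq_mul_inv_iff_mul_eq] at this
    exact this.symm

theorem quotient_of_le (hC : IsRootClass C) (hquot : QuotClosed C) {B : Type u} [Group B]
    {N M : Subgroup B} [N.Normal] [M.Normal] (hNM : N ≤ M) (h : C (B ⧸ N)) : C (B ⧸ M) :=
  hC.of_surjective hquot (QuotientGroup.map N M (MonoidHom.id B) hNM)
    (fun y => by
      obtain ⟨y, rfl⟩ := QuotientGroup.mk_surjective y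
      exact ⟨QuotientGroup.mk y, rfl⟩) h

theorem quotient_subgroupOf (hC : IsRootClass C) {B : Type u} [Group B] (S M : Subgroup B)
    [M.Normal] (h : C (B ⧸ M)) : C (S ⧸ M.subgroupOf S) := by
  refine hC.of_injective (QuotientGroup.map (M.subgroupOf S) M S.subtype le_rfl) ?_ h
  rw [injective_iff_map_eq_one]
  intro y hy
  obtain ⟨y, rfl⟩ := QuotientGroup.mk_surjective y
  exact (QuotientGroup.eq_one_iff y).2 ((QuotientGroup.eq_one_iff (y : B)).1 hy)

theorem map_of_forall_mem_range (hC : IsRootClass C) (hquot : QuotClosed C)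
    {B Q G G' : Type u} [Group B] [Group Q] [Group G] [Group G'] (s : B →* Q) (hQ : C Q)
    (r : G →* G') (c : B →* G) (S : Subgroup G) (hS : S ≤ c.range)
    (h : ∀ b, s b = 1 → r (c b) = 1) : C (S.map r) := by
  have := hC.range_of_le_ker hquot (r.comp c) s.ker h (hC.quotient_ker s hQ)
  rw [MonoidHom.range_comp] at this
  exact hC.of_le (Subgroup.map_mono hS) this

end IsRootClass

section Admissible

variable {C : GroupClass.{u}} {B Q : Type u} [Group B] [Group Q] {H K : Subgroup B} {φ : H ≃* K}
  {ψ : MulAut ↥(H ⊓ K)} {s : B →* Q}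

theorem IsRestrictionToL.coe_apply (hψ : IsRestrictionToL H K φ ψ) {x : B} (hx : x ∈ H ⊓ K) :
    ((φ ⟨x, hx.1⟩ : K) : B) = ψ ⟨x, hx⟩ :=
  (hψ ⟨x, hx⟩).symm

theorem mem_inf_sup_ker {x : B} : x ∈ (H ⊓ K) ⊔ s.ker ↔ ∃ l ∈ H ⊓ K, s l = s x := by
  rw [← Subgroup.comap_map_eq]
  rfl

theorem IsAdmissible.apply_eq_iff (hs : IsAdmissible φ s) (h h' : H) :
    s (φ h) = s (φ h') ↔ s h = s h' := by
  rw [← div_eq_one, ← map_div, ← div_eq_one (a := s h), ← map_div]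
  have := hs.compat (h / h')
  rw [map_div, Subgroup.coe_div, Subgroup.coe_div] at this
  exact this.symm

theorem IsAdmissible.mem_sup_iff (hs : IsAdmissible φ s) (hψ : IsRestrictionToL H K φ ψ) (h : H) :
    (φ h : B) ∈ (H ⊓ K) ⊔ s.ker ↔ (h : B) ∈ (H ⊓ K) ⊔ s.ker := by
  rw [mem_inf_sup_ker, mem_inf_sup_ker]
  constructor
  · rintro ⟨l, hl, e⟩
    refine ⟨ψ⁻¹ ⟨l, hl⟩, SetLike.coe_mem _, ?_⟩
    rw [← hs.apply_eq_iff ⟨_, (ψ⁻¹ ⟨l, hl⟩).2.1⟩, hψ.coe_apply (SetLike.coe_mem _), ← e]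
    simp
  · rintro ⟨l, hl, e⟩
    refine ⟨ψ ⟨l, hl⟩, SetLike.coe_mem _, ?_⟩
    rwa [← hψ.coe_apply, hs.apply_eq_iff]

theorem IsAdmissible.mem_sup_of_apply_eq (hs : IsAdmissible φ s) {h k : B} (hh : h ∈ H)
    (hk : k ∈ K) (e : s h = s k) : h ∈ (H ⊓ K) ⊔ s.ker := by
  obtain ⟨l, hl, e'⟩ := hs.sep h hh k⁻¹ (inv_mem hk) (by rw [map_mul, map_inv, e, mul_inv_cancel])
  refine mem_inf_sup_ker.2 ⟨l⁻¹, inv_mem hl, ?_⟩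
  rw [map_mul] at e'
  rw [map_inv, inv_eq_of_mul_eq_one_left e']

theorem IsAdmissible.frakV_le (hs : IsAdmissible φ s) (hψ : IsRestrictionToL H K φ ψ) :
    frakV H K ψ ≤ invariantAut (s.ker.subgroupOf (H ⊓ K)) := by
  refine sup_le (autOf_le_invariantAut _ _) (zpowers_le.2 fun l => ?_)
  rw [mem_subgroupOf, mem_subgroupOf, MonoidHom.mem_ker, MonoidHom.mem_ker, hψ,
    ← hs.compat]

variable [K.Normal]

/-- The element of `Aut(H)` induced through `φ` by the conjugation by `b` on `K`. -/
def conjThrough (φ : H ≃* K) : B →* MulAut H := (autConjHom φ).comp MulAut.conjNormal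

theorem coe_conjThrough_apply (b : B) (h : H) :
    (φ (conjThrough φ b h) : B) = b * φ h * b⁻¹ := by
  simp [conjThrough, autConjHom]

theorem autOf_le_range_conjNormal (Y : Subgroup B) [Y.Normal] :
    autOf B Y ≤ (MulAut.conjNormal : B →* MulAut Y).range := by
  rintro u ⟨b, hb⟩
  exact ⟨b, MulEquiv.ext fun y => Subtype.ext ((MulAut.conjNormal_apply b y).trans (hb y).symm)⟩

theorem conjThrough_mem_frakK (b : B) : conjThrough φ b ∈ frakK H K φ :=
  ⟨_, conjNormal_mem_autOf K b, rfl⟩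

theorem frakK_le_range_conjThrough : frakK H K φ ≤ (conjThrough φ).range := by
  rw [conjThrough, MonoidHom.range_comp]
  exact Subgroup.map_mono (autOf_le_range_conjNormal K)

variable [H.Normal]

theorem IsAdmissible.frakU_le (hs : IsAdmissible φ s) (hψ : IsRestrictionToL H K φ ψ) :
    frakU H K φ ≤ invariantAut ((H ⊓ K ⊔ s.ker).subgroupOf H) := by
  refine sup_le (autOf_le_invariantAut _ _) ?_
  rintro _ ⟨u, hu, rfl⟩ h
  have := autOf_le_invariantAut _ (H ⊓ K ⊔ s.ker) hu (φ h)
  rw [mem_subgroupOf, mem_subgroupOf] at this ⊢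
  rw [← hs.mem_sup_iff hψ h, ← this, ← hs.mem_sup_iff hψ]
  simp [autConjHom]

theorem IsRootClass.map_quotientAction (hC : IsRootClass C) (hquot : QuotClosed C) (hQ : C Q)
    {Y : Type u} [Group Y] {U : Subgroup (MulAut Y)} {J : Subgroup Y} [J.Normal]
    (hU : U ≤ invariantAut J) (c : B →* MulAut Y) (S : Subgroup (MulAut Y)) (hS : S ≤ c.range)
    (hc : ∀ b, c b ∈ U) (h : ∀ b, s b = 1 → ∀ y, (c b y : Y ⧸ J) = y) :
    C ((S.subgroupOf U).map (quotientAction hU)) := by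
  refine hC.map_of_forall_mem_range hquot s hQ _ (c.codRestrict U hc) _ ?_ fun b hb => ?_
  · intro u hu
    obtain ⟨b, hb⟩ := hS hu
    exact ⟨b, Subtype.ext hb⟩
  · refine MulEquiv.ext fun y => ?_
    obtain ⟨y, rfl⟩ := QuotientGroup.mk_surjective y
    exact h b hb y

theorem mk_conjNormal_eq (Y N : Subgroup B) [Y.Normal] [N.Normal] {b : B} (hb : b ∈ N) (y : Y) :
    (MulAut.conjNormal b y : Y ⧸ N.subgroupOf Y) = y := by
  rw [QuotientGroup.eq, mem_subgroupOf, Subgroup.coe_mul, Subgroup.coe_inv,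
    MulAut.conjNormal_apply]
  have := N.mul_mem hb (Normal.conj_mem inferInstance b⁻¹ (N.inv_mem hb) (y : B)⁻¹)
  simpa [mul_assoc] using this

theorem IsAdmissible.range_frakU (hs : IsAdmissible φ s) (hC : IsRootClass C)
    (hquot : QuotClosed C) (hQ : C Q) (hψ : IsRestrictionToL H K φ ψ) (hU : CondDag C H K φ) :
    C (quotientAction (hs.frakU_le hψ)).range := by
  refine hC.map_sup hquot (S := autOf B H) (T := frakK H K φ) _ ?_ ?_ hU
  · exact hC.map_quotientAction hquot hQ (s := s) (hs.frakU_le hψ) _ _ (autOf_le_range_conjNormal H)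
      (fun b => mem_sup_left (conjNormal_mem_autOf H b))
      fun b hb => mk_conjNormal_eq _ _ (mem_sup_right hb)
  · refine hC.map_quotientAction hquot hQ (s := s) (hs.frakU_le hψ) _ _ frakK_le_range_conjThrough
      (fun b => mem_sup_right (conjThrough_mem_frakK b)) fun b hb h => ?_
    have : s (conjThrough φ b h) = s h := by
      rw [← hs.apply_eq_iff, coe_conjThrough_apply]
      simp [hb]
    rw [QuotientGroup.eq, mem_subgroupOf]
    refine mem_sup_right ?_
    rw [MonoidHom.mem_ker, Subgroup.coe_mul, Subgroup.coe_inv, map_mul, map_inv, this,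
      inv_mul_cancel]

theorem IsAdmissible.range_frakV (hs : IsAdmissible φ s) (hC : IsRootClass C)
    (hquot : QuotClosed C) (hQ : C Q) (hψ : IsRestrictionToL H K φ ψ) (hV : CondDDag C H K ψ)
    (hF : C ↥(zpowers ψ)) :
    C (quotientAction (hs.frakV_le hψ)).range := by
  refine hC.map_sup hquot (S := autOf B (H ⊓ K)) (T := zpowers ψ) _ ?_ ?_ hV
  · exact hC.map_quotientAction hquot hQ (s := s) (hs.frakV_le hψ) _ _
      (autOf_le_range_conjNormal (H ⊓ K))
      (fun b => mem_sup_left (conjNormal_mem_autOf _ b))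
      fun b hb => mk_conjNormal_eq _ _ hb
  · refine hC.map hquot _ _ (hC.1 _ _ (subgroupOfEquivOfLe ?_).symm hF)
    exact le_sup_right

theorem IsAdmissible.exists_intertwined_ker_le_sup (hs : IsAdmissible φ s) (hC : IsRootClass C)
    (hquot : QuotClosed C) (hQ : C Q) (hψ : IsRestrictionToL H K φ ψ) (hU : CondDag C H K φ) :
    ∃ (X : Type u) (_ : Group X) (F : B →* X) (τ : X), C X ∧ (∀ h : H, τ * F h = F (φ h) * τ) ∧
      ∀ b, F b = 1 → b ∈ (H ⊓ K) ⊔ s.ker := by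
  obtain ⟨Z, _, hZ, _⟩ := hC.2.1
  have hBs : C (B ⧸ s.ker) := hC.quotient_ker s hQ
  obtain ⟨A, _, i, ρ, hA, hi, hρ⟩ := hC.exists_equivariant (hs.frakU_le hψ)
    (hC.quotient_subgroupOf _ _ (hC.quotient_of_le hquot le_sup_right hBs))
    (hs.range_frakU hC hquot hQ hψ hU)
  let M := (H ⊔ K) ⊔ s.ker
  let σ := QuotientGroup.mk' M
  have hσ : σ.ker = M := QuotientGroup.ker_mk' M
  have hmem (b : B) : b ∈ σ.ker ↔ b ∈ M := by rw [hσ]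
  have hHM : H ≤ M := le_sup_left.trans le_sup_left
  have hKM : K ≤ M := le_sup_right.trans le_sup_left
  have hM₁ : σ.ker ≤ H ⊔ (K ⊔ s.ker) := by rw [hσ, ← sup_assoc]
  have hM₂ : σ.ker ≤ K ⊔ (H ⊔ s.ker) := by rw [hσ, ← sup_assoc, sup_comm K H]
  have hi' (k : K) : i (φ.symm k) = 1 ↔ (k : B) ∈ (H ⊓ K) ⊔ s.ker := by
    rw [hi, mem_subgroupOf, ← hs.mem_sup_iff hψ, φ.apply_symm_apply]
  obtain ⟨j₁, hj₁⟩ := exists_hom_of_le_sup hM₁ i fun x hx => by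
    obtain ⟨k, hk, n, hn, e⟩ := mem_sup_of_normal_right.1 hx
    refine (hi x).2 (hs.mem_sup_of_apply_eq x.2 hk ?_)
    rw [subtype_apply, ← e, map_mul, MonoidHom.mem_ker.1 hn, mul_one]
  obtain ⟨j₂, hj₂⟩ := exists_hom_of_le_sup hM₂ (i.comp φ.symm.toMonoidHom) fun x hx => by
    obtain ⟨h, hh, n, hn, e⟩ := mem_sup_of_normal_right.1 hx
    refine (hi' x).2 ?_
    rw [← e]
    refine mul_mem (hs.mem_sup_of_apply_eq hh x.2 ?_) (mem_sup_right hn)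
    rw [← e, map_mul, MonoidHom.mem_ker.1 hn, mul_one]
  obtain ⟨f₁, hf₁, hf₁'⟩ := exists_hom_wreath σ j₁
    (ρ.comp (MulAut.conjNormal.codRestrict (frakU H K φ)
      fun b => mem_sup_left (conjNormal_mem_autOf H b))) (by
      intro g m m' e
      obtain ⟨h, hh, t, ht, e'⟩ := mem_sup_of_normal_right.1 (hM₁ m.2)
      rw [hj₁ m ⟨h, hh⟩ t ht e'.symm,
        hj₁ m' (MulAut.conjNormal g ⟨h, hh⟩) _ (Normal.conj_mem inferInstance t ht g) (by
          rw [e, ← e', MulAut.conjNormal_apply]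
          simp [mul_assoc])]
      exact hρ _ _)
  obtain ⟨f₂, hf₂, hf₂'⟩ := exists_hom_wreath σ j₂
    (ρ.comp ((conjThrough φ).codRestrict (frakU H K φ)
      fun b => mem_sup_right (conjThrough_mem_frakK b))) (by
      intro g m m' e
      obtain ⟨k, hk, t, ht, e'⟩ := mem_sup_of_normal_right.1 (hM₂ m.2)
      have hc : φ.symm (MulAut.conjNormal g ⟨k, hk⟩) = conjThrough φ g (φ.symm ⟨k, hk⟩) := by
        simp [conjThrough, autConjHom]
      rw [hj₂ m ⟨k, hk⟩ t ht e'.symm,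
        hj₂ m' (MulAut.conjNormal g ⟨k, hk⟩) _ (Normal.conj_mem inferInstance t ht g) (by
          rw [e, ← e', MulAut.conjNormal_apply]
          simp [mul_assoc])]
      change _ = i (φ.symm _) * _
      rw [hc]
      exact hρ _ _)
  have hσ1 (b : B) (hb : b ∈ M) : σ b = 1 := (hmem b).2 hb
  obtain ⟨F, τ, hF, hF'⟩ := exists_wreath_swap (Z := Z) H K φ f₁ f₂ (by
    intro h
    refine RegularWreathProduct.ext (funext fun x => ?_) ?_
    · rw [hf₁' ⟨h, (hmem _).2 (hHM h.2)⟩ x, hf₂' ⟨φ h, (hmem _).2 (hKM (φ h).2)⟩ x,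
        hj₁ _ h 1 (one_mem _) (mul_one _).symm, hj₂ _ (φ h) 1 (one_mem _) (mul_one _).symm]
      simp
    · rw [hf₁, hf₂, hσ1 _ (hHM h.2), hσ1 _ (hKM (φ h).2)]) (by
    intro k hk
    refine RegularWreathProduct.ext (funext fun x => ?_) ?_
    · rw [hf₁' ⟨k, (hmem _).2 (hKM hk)⟩ x, hj₁ _ 1 k (mem_sup_left hk) (one_mul _).symm, map_one]
      rfl
    · rw [hf₁, hσ1 _ (hKM hk)]
      rfl) (by
    intro h hh
    refine RegularWreathProduct.ext (funext fun x => ?_) ?_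
    · rw [hf₂' ⟨h, (hmem _).2 (hHM hh)⟩ x, hj₂ _ 1 h (mem_sup_left hh) (one_mul _).symm, map_one]
      rfl
    · rw [hf₂, hσ1 _ (hHM hh)]
      rfl)
  refine ⟨_, inferInstance, F, τ, hC.wreath (hC.wreath hA (hC.quotient_of_le hquot le_sup_right hBs))
    hZ, hF, fun b hb => ?_⟩
  obtain ⟨hb₁, hb₂⟩ := (hF' b).1 hb
  have hbσ : b ∈ σ.ker := by
    rw [MonoidHom.mem_ker, ← hf₁, hb₁]
    rfl
  obtain ⟨h, hh, t, ht, rfl⟩ := mem_sup_of_normal_right.1 (hM₁ hbσ)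
  obtain ⟨k, hk, n, hn, rfl⟩ := mem_sup_of_normal_right.1 ht
  have h₁ : i ⟨h, hh⟩ = 1 := by
    rw [← hj₁ ⟨_, hbσ⟩ ⟨h, hh⟩ _ ht rfl, ← hf₁' _ 1, hb₁]
    rfl
  have h₂ : i (φ.symm ⟨k, hk⟩) = 1 := by
    have := hj₂ ⟨_, hbσ⟩ ⟨k, hk⟩ (k⁻¹ * h * k * n) (mul_mem (mem_sup_left
      (by simpa using Normal.conj_mem inferInstance h hh k⁻¹)) (mem_sup_right hn)) (by
        simp [mul_assoc])
    rw [← hf₂' _ 1, hb₂] at this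
    exact this.symm
  exact mul_mem ((hi _).1 h₁) (mul_mem ((hi' _).1 h₂) (mem_sup_right hn))

theorem IsAdmissible.exists_intertwined (hs : IsAdmissible φ s) (hC : IsRootClass C)
    (hquot : QuotClosed C) (hQ : C Q) (hψ : IsRestrictionToL H K φ ψ) (hU : CondDag C H K φ)
    (hV : CondDDag C H K ψ) (hF : C ↥(zpowers ψ)) :
    ∃ (X : Type u) (_ : Group X) (F : B →* X) (τ : X), C X ∧ (∀ h : H, τ * F h = F (φ h) * τ) ∧
      ∀ b, F b = 1 → s b = 1 := by
  obtain ⟨X, _, F, τ, hX, hFτ, hFs⟩ := hs.exists_intertwined_ker_le_sup hC hquot hQ hψ hU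
  obtain ⟨A, _, i, ρ, hA, hi, hρ⟩ := hC.exists_equivariant (hs.frakV_le hψ)
    (hC.quotient_subgroupOf _ _ (hC.quotient_ker s hQ)) (hs.range_frakV hC hquot hQ hψ hV hF)
  obtain ⟨j, hj⟩ := exists_hom_of_le_sup (M := F.ker) hFs i fun x hx => (hi x).2 hx
  obtain ⟨f, hf, hf'⟩ := exists_hom_wreath F j
    (ρ.comp (MulAut.conjNormal.codRestrict (frakV H K ψ)
      fun b => mem_sup_left (conjNormal_mem_autOf _ b))) (by
      intro g m m' e
      obtain ⟨l, hl, t, ht, e'⟩ := mem_sup_of_normal_right.1 (hFs m m.2)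
      rw [hj m ⟨l, hl⟩ t ht e'.symm,
        hj m' (MulAut.conjNormal g ⟨l, hl⟩) _ (Normal.conj_mem inferInstance t ht g) (by
          rw [e, ← e', MulAut.conjNormal_apply]
          simp [mul_assoc])]
      exact hρ _ _)
  let v := ρ ⟨ψ, mem_sup_right (mem_zpowers ψ)⟩
  let τ₀ : A ≀ᵣ X := ⟨fun _ => v, τ⟩
  have hFsymm (k : K) : τ * F (φ.symm k) = F k * τ := by
    rw [hFτ, φ.apply_symm_apply]
  obtain ⟨d, hd⟩ := exists_wreath_conj (F.comp K.subtype) (f.comp K.subtype)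
    ((MulAut.conj τ₀).toMonoidHom.comp (f.comp (H.subtype.comp φ.symm.toMonoidHom)))
    (fun k => hf k) (fun k => by
      change τ * (f (φ.symm k)).right * τ⁻¹ = F k
      rw [hf, hFsymm, mul_inv_cancel_right]) (by
      intro k hk
      change f k = τ₀ * f (φ.symm k) * τ₀⁻¹
      rw [eq_mul_inv_iff_mul_eq]
      have hk1 : F k = 1 := hk
      have hk2 : F (φ.symm k) = 1 := by
        have := hFsymm k
        rwa [hk1, one_mul, mul_eq_left] at this
      obtain ⟨l, hl, n, hn, e⟩ := mem_sup_of_normal_right.1 (hFs _ hk2)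
      have hnH : n ∈ H := by
        refine (H.mul_mem_cancel_left hl.1).1 ?_
        rw [e]
        exact SetLike.coe_mem _
      have e' : (k : B) = ψ ⟨l, hl⟩ * φ ⟨n, hnH⟩ := by
        rw [← hψ.coe_apply hl, ← Subgroup.coe_mul, ← map_mul]
        have : (⟨l, hl.1⟩ * ⟨n, hnH⟩ : H) = φ.symm k := Subtype.ext e
        rw [this, φ.apply_symm_apply]
      refine RegularWreathProduct.ext (funext fun x => ?_) ?_
      · change (f k).left x * v = v * (f (φ.symm k)).left (τ⁻¹ * x)
        rw [hf' ⟨k, hk1⟩, hf' ⟨φ.symm k, hk2⟩, hj ⟨k, hk1⟩ (ψ ⟨l, hl⟩) _ ((hs.compat ⟨n, hnH⟩).1 hn) e',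
          hj ⟨φ.symm k, hk2⟩ ⟨l, hl⟩ n hn e.symm]
        exact (hρ ⟨ψ, mem_sup_right (mem_zpowers ψ)⟩ ⟨l, hl⟩).symm
      · change (f k).right * τ = τ * (f (φ.symm k)).right
        rw [hf, hf, hk1, hk2, one_mul, mul_one])
  refine ⟨A ≀ᵣ X, inferInstance, f, ⟨d, 1⟩ * τ₀, hC.wreath hA hX, fun h => ?_, fun b hb => ?_⟩
  · have := hd (φ h)
    change (⟨d, 1⟩ : A ≀ᵣ X) * (τ₀ * f (φ.symm (φ h)) * τ₀⁻¹) = f (φ h) * ⟨d, 1⟩ at this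
    rw [φ.symm_apply_apply, ← mul_assoc, mul_inv_eq_iff_eq_mul, mul_assoc (f (φ h) : A ≀ᵣ X),
      ← mul_assoc] at this
    exact this
  · have hb1 : F b = 1 := by
      rw [← hf, hb]
      rfl
    obtain ⟨l, hl, n, hn, rfl⟩ := mem_sup_of_normal_right.1 (hFs _ hb1)
    have : i ⟨l, hl⟩ = 1 := by
      rw [← hj ⟨_, hb1⟩ ⟨l, hl⟩ n hn rfl, ← hf' _ 1, hb]
      rfl
    rw [map_mul, MonoidHom.mem_ker.1 hn, mul_one]
    exact (hi _).1 this

end Admissible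

theorem statement_18 (C : GroupClass.{u}) (hroot : IsRootClass C) (hquot : QuotClosed C)
    {B : Type u} [Group B] (H K : Subgroup B) (φ : H ≃* K)
    (hH : H.Normal) (hK : K.Normal)
    (ψ : MulAut ↥(H ⊓ K)) (hψ : IsRestrictionToL H K φ ψ)
    (hqr : QuasiRegular C B (H ⊔ K))
    (hab :
      (C ↥(frakV H K ψ) ∧ C (↥H ⧸ (H ⊓ K).subgroupOf H) ∧ CondDag C H K φ) ∨
      (C ↥(frakU H K φ) ∧ C ↥(Subgroup.zpowers ψ) ∧
        (∃ (G : Type u) (_ : Group G) (σ : B →* G), Function.Surjective σ ∧ C G ∧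
          Function.Injective (σ.comp (H ⊓ K).subtype)) ∧ CondDDag C H K ψ))
    (hBH : Residually C (B ⧸ H)) (hBK : Residually C (B ⧸ K)) :
    Residually C (HNNExtension B H K φ) ↔ Residually C B := by
  refine ⟨hroot.residually_of_injective HNNExtension.of (HNNExtension.of_injective φ),
    fun hB => HNNExtension.residually hroot hB hBH hBK fun Q _ r hQ => ?_⟩
  have key : CondDag C H K φ ∧ CondDDag C H K ψ ∧ C ↥(zpowers ψ) ∧
      ∃ (Q' : Type u) (_ : Group Q') (s : B →* Q'), C Q' ∧ (∀ b, s b = 1 → r b = 1) ∧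
        IsAdmissible φ s := by
    rcases hab with ⟨hV, hHL, hU⟩ | ⟨hU, hF, ⟨G, _, σ, -, hG, hσ⟩, hV⟩
    · exact ⟨hU, Or.inr (Or.inr hV), hroot.of_le le_sup_right hV,
        hroot.exists_isAdmissible_of_frakV hquot hqr hψ hV hHL r hQ⟩
    · exact ⟨Or.inr (Or.inr hU), hV, hF,
        hroot.exists_isAdmissible_of_frakU hquot hqr hU σ hG hσ r hQ⟩
  obtain ⟨hU, hV, hF, Q', _, s, hQ', hsr, hs⟩ := key
  obtain ⟨X, _, F, τ, hX, hFτ, hFs⟩ := hs.exists_intertwined hroot hquot hQ' hψ hU hV hF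
  refine ⟨X, inferInstance, HNNExtension.lift F τ hFτ, hX, fun b hb => hsr b (hFs b ?_)⟩
  rwa [HNNExtension.lift_of] at hb
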